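/- arXiv:1409.7322 — 2 statements merged into one kernel-verified Lean document; each statement's English description precedes it below -/
import Mathlib

section
/- The 3x+1 conjecture holds if and only if for every positive integer x, writing x in base 3 as x_k…x_0 (most significant digit first, x_k ≠ 0), there exists an integer n ≥ 0 such that the Turing machine M1, started from the configuration ωb (A x_k) x_{k−1} … x_0 bω, eventually reaches the configuration ωb 0^n (A 1) bω. -/
namespace Collatz

/-- The 3x+1 function. -/
def T (x : ℕ) : ℕ := if x % 2 = 0 then x / 2 else (3 * x + 1) / 2

/-- The 3x+1 conjecture: iterating `T` from any positive integer
eventually reaches the loop `2 ↦ 1 ↦ 2`. -/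
def CollatzConjecture : Prop :=
  ∀ x : ℕ, 0 < x → ∃ k : ℕ, T^[k] x = 2 ∧ T^[k + 1] x = 1

inductive St | A | B | C
  deriving DecidableEq

inductive Sym | blank | d0 | d1 | d2
  deriving DecidableEq

open St Sym

/-- Transition table of the Turing machine `M1`
(`true` = move right, `false` = move left). -/
def delta : St → Sym → Option (Sym × Bool × St)
  | A, blank => some (blank, false, C)
  | A, d0    => some (d0, true, A)
  | A, d1    => some (d0, true, B)
  | A, d2    => some (d1, true, A)
  | B, blank => some (d2, false, C)
  | B, d0    => some (d1, true, B)
  | B, d1    => some (d2, true, A)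
  | B, d2    => some (d2, true, B)
  | C, blank => some (blank, true, A)
  | C, d0    => some (d0, false, C)
  | C, d1    => some (d1, false, C)
  | C, d2    => some (d2, false, C)

structure Cfg where
  state : St
  head : ℤ
  tape : ℤ → Sym

/-- One step of the machine; `none` when the transition is undefined
(in particular in the halting state, which has no transitions).
In `delta`, the `Bool` component is the direction: `true` = right, `false` = left. -/
def step (c : Cfg) : Option Cfg :=
  (delta c.state (c.tape c.head)).map fun t =>
    ⟨t.2.2, c.head + (if t.2.1 then 1 else -1), Function.update c.tape c.head t.1⟩

/-- `steps n c` is the configuration after `n` steps from `c`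
(`none` if the machine has halted meanwhile). -/
def steps : ℕ → Cfg → Option Cfg
  | 0, c => some c
  | n + 1, c => (step c).bind (steps n)

/-- The tape holding the word `w` at positions `0, …, w.length - 1`,
and the blank symbol everywhere else. -/
def tapeOf (w : List Sym) : ℤ → Sym :=
  fun i => if 0 ≤ i then w.getD i.toNat blank else blank

/-- `c` is the configuration `ωb u (q s) v bω`, where `w = u ++ s :: v` and
`pos = u.length` (i.e. the tape holds exactly the word `w` surrounded by blanks,
the machine is in state `q`, and the head scans the symbol of `w` at index `pos`). -/
def IsConfig (c : Cfg) (q : St) (w : List Sym) (pos : ℕ) : Prop :=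
  c.state = q ∧ ∃ d : ℤ, c.head = d + pos ∧ c.tape = fun i => tapeOf w (i - d)

/-- The machine eventually reaches the configuration `ωb u (q s) v bω`. -/
def Reaches (c : Cfg) (q : St) (w : List Sym) (pos : ℕ) : Prop :=
  ∃ t : ℕ, ∃ c' : Cfg, steps t c = some c' ∧ IsConfig c' q w pos

/-- The machine halts when started from configuration `c`. -/
def Halts (c : Cfg) : Prop := ∃ n : ℕ, steps n c = none

/-- Initial configuration: word `w` on the tape, head on its leftmost symbol, state `A`. -/
def initCfg (w : List Sym) : Cfg := ⟨St.A, 0, tapeOf w⟩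

/-- The symbol encoding a base-3 digit. -/
def symOfDigit (n : ℕ) : Sym := if n = 0 then d0 else if n = 1 then d1 else d2

/-- The standard base-3 representation of `x`, most significant digit first. -/
def base3Word (x : ℕ) : List Sym := ((Nat.digits 3 x).reverse).map symOfDigit

/-- Symbol of a ternary digit. -/
def sy : Fin 3 → Sym
  | 0 => d0
  | 1 => d1
  | 2 => d2

/-- `R t h u v`: to the left of the boundary `h` the tape reads `u` (nearest first), from `h`
on it reads `v`. -/
def R (t : ℤ → Sym) (h : ℤ) (u v : List Sym) : Prop :=
  ∀ j : ℕ, t (h - 1 - j) = u.getD j blank ∧ t (h + j) = v.getD j blank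

lemma R_head {t h u s v} (H : R t h u (s :: v)) : t h = s := by
  simpa using (H 0).2

lemma R_head_nil {t h u} (H : R t h u []) : t h = blank := by
  simpa using (H 0).2

lemma R_last {t h u s v} (H : R t (h + 1) (s :: u) v) : t h = s := by
  simpa using (H 0).1

lemma R_last_nil {t h v} (H : R t (h + 1) [] v) : t h = blank := by
  simpa using (H 0).1

lemma R_right {t h u s v} (s' : Sym) (H : R t h u (s :: v)) :
    R (Function.update t h s') (h + 1) (s' :: u) v := by
  intro j
  constructor
  · rcases j with _ | j
    · simp
    · have := (H j).1
      rw [Function.update_of_ne (by push_cast; omega)]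
      rw [List.getD_cons_succ, ← this]
      congr 1
      push_cast
      ring
  · have := (H (j + 1)).2
    rw [Function.update_of_ne (by omega)]
    rw [List.getD_cons_succ] at this
    rw [← this]
    congr 1
    push_cast
    ring

lemma R_write {t h u} (s' : Sym) (H : R t h u []) :
    R (Function.update t h s') h u [s'] := by
  intro j
  constructor
  · rw [Function.update_of_ne (by omega)]
    exact (H j).1
  · rcases j with _ | j
    · simp
    · have := (H (j + 1)).2
      rw [Function.update_of_ne (by push_cast; omega), this]
      simp

lemma R_left {t h u s v} (H : R t (h + 1) (s :: u) v) : R t h u (s :: v) := by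
  intro j
  constructor
  · have := (H (j + 1)).1
    rw [List.getD_cons_succ] at this
    rw [← this]
    congr 1
    push_cast
    ring
  · rcases j with _ | j
    · simpa using R_last H
    · have := (H j).2
      rw [List.getD_cons_succ, ← this]
      congr 1
      push_cast
      ring

/-- Abstract configurations. -/
abbrev AC := St × List (Fin 3) × List (Fin 3)

/-- Abstract step. -/
def astep : AC → AC
  | (A, u, []) => (C, u, [])
  | (A, u, 0 :: v) => (A, 0 :: u, v)
  | (A, u, 1 :: v) => (B, 0 :: u, v)
  | (A, u, 2 :: v) => (A, 1 :: u, v)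
  | (B, u, []) => (C, u, [2])
  | (B, u, 0 :: v) => (B, 1 :: u, v)
  | (B, u, 1 :: v) => (A, 2 :: u, v)
  | (B, u, 2 :: v) => (B, 2 :: u, v)
  | (C, s :: u, v) => (C, u, s :: v)
  | (C, [], v) => (A, [], v)

/-- Position of the boundary relative to the head. -/
def off : St → ℤ
  | C => 1
  | _ => 0

/-- `c` is represented by the abstract configuration `a`. -/
def Good (c : Cfg) (a : AC) : Prop :=
  c.state = a.1 ∧ R c.tape (c.head + off a.1) (a.2.1.map sy) (a.2.2.map sy)

lemma good_step (c : Cfg) (a : AC) (H : Good c a) :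
    ∃ c', step c = some c' ∧ Good c' (astep a) := by
  obtain ⟨q, h, t⟩ := c
  obtain ⟨q', u, v⟩ := a
  obtain ⟨h1, h2⟩ := H
  simp only at h1 h2
  subst h1
  cases q
  · simp only [off, add_zero] at h2
    rcases v with _ | ⟨s, v⟩
    · have e : t h = blank := R_head_nil h2
      refine ⟨_, by simp only [step, e, delta]; rfl, rfl, ?_⟩
      have e2 : Function.update t h blank = t := by rw [← e]; simp
      simpa [astep, off, e2] using h2
    · have e := R_head h2
      fin_cases s
      · refine ⟨_, by simp only [step, e, delta, sy]; rfl, rfl, ?_⟩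
        simpa [astep, off, sy] using R_right d0 h2
      · refine ⟨_, by simp only [step, e, delta, sy]; rfl, rfl, ?_⟩
        simpa [astep, off, sy] using R_right d0 h2
      · refine ⟨_, by simp only [step, e, delta, sy]; rfl, rfl, ?_⟩
        simpa [astep, off, sy] using R_right d1 h2
  · simp only [off, add_zero] at h2
    rcases v with _ | ⟨s, v⟩
    · have e : t h = blank := R_head_nil h2
      refine ⟨_, by simp only [step, e, delta]; rfl, rfl, ?_⟩
      simpa [astep, off, sy] using R_write d2 h2
    · have e := R_head h2
      fin_cases s
      · refine ⟨_, by simp only [step, e, delta, sy]; rfl, rfl, ?_⟩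
        simpa [astep, off, sy] using R_right d1 h2
      · refine ⟨_, by simp only [step, e, delta, sy]; rfl, rfl, ?_⟩
        simpa [astep, off, sy] using R_right d2 h2
      · refine ⟨_, by simp only [step, e, delta, sy]; rfl, rfl, ?_⟩
        simpa [astep, off, sy] using R_right d2 h2
  · simp only [off] at h2
    rcases u with _ | ⟨s, u⟩
    · have e : t h = blank := R_last_nil h2
      refine ⟨_, by simp only [step, e, delta]; rfl, rfl, ?_⟩
      have e2 : Function.update t h blank = t := by rw [← e]; simp
      simpa [astep, off, e2] using h2
    · have e := R_last h2
      have e2 : Function.update t h (sy s) = t := by rw [← e]; simp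
      have key : step ⟨C, h, t⟩ = some ⟨C, h + -1, t⟩ := by
        conv_rhs => rw [← e2]
        fin_cases s <;> simp only [step, e, delta, sy] <;> rfl
      refine ⟨_, key, rfl, ?_⟩
      simpa [astep, off] using R_left h2

lemma good_steps (t : ℕ) : ∀ (c : Cfg) (a : AC), Good c a →
    ∃ c', steps t c = some c' ∧ Good c' (astep^[t] a) := by
  induction t with
  | zero => exact fun c a H => ⟨c, rfl, H⟩
  | succ t ih =>
    intro c a H
    obtain ⟨c1, e1, H1⟩ := good_step c a H
    obtain ⟨c2, e2, H2⟩ := ih c1 _ H1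
    exact ⟨c2, by simp [steps, e1, e2], by simpa using H2⟩

/-- Value of a word, least significant digit first. -/
def vr : List (Fin 3) → ℕ
  | [] => 0
  | a :: u => a.val + 3 * vr u

/-- Value of a word, most significant digit first. -/
def vl : List (Fin 3) → ℕ
  | [] => 0
  | a :: v => a.val * 3 ^ v.length + vl v

/-- The integer an abstract configuration stands for. -/
def W : AC → ℕ
  | (A, u, v) => 2 * vr u * 3 ^ v.length + vl v
  | (B, u, v) => (2 * vr u + 1) * 3 ^ v.length + vl v
  | (C, u, v) => vr u * 3 ^ v.length + vl v

lemma T_even (m : ℕ) : T (2 * m) = m := by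
  unfold T; split_ifs <;> omega

lemma T_odd (m : ℕ) : T (2 * m + 1) = 3 * m + 2 := by
  unfold T; split_ifs <;> omega

lemma W_A_nil (u) : W (astep (A, u, [])) = T (W (A, u, [])) := by
  simp [astep, W, vl, T_even]

lemma W_B_nil (u) : W (astep (B, u, [])) = T (W (B, u, [])) := by
  simp only [astep, W, vl, List.length_nil, List.length_cons, pow_zero, mul_one, add_zero, T_odd]
  simp
  ring

lemma W_A_cons (u s v) : W (astep (A, u, s :: v)) = W (A, u, s :: v) := by
  fin_cases s <;> simp [astep, W, vl, vr] <;> ring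

lemma W_B_cons (u s v) : W (astep (B, u, s :: v)) = W (B, u, s :: v) := by
  fin_cases s <;> simp [astep, W, vl, vr] <;> ring

lemma W_C (u v) : W (astep (C, u, v)) = W (C, u, v) := by
  rcases u with _ | ⟨s, u⟩
  · simp [astep, W, vr]
  · simp [astep, W, vl, vr]; ring

lemma W_step (a : AC) : W (astep a) = W a ∨ W (astep a) = T (W a) := by
  obtain ⟨q, u, v⟩ := a
  cases q
  · rcases v with _ | ⟨s, v⟩
    · exact Or.inr (W_A_nil u)
    · exact Or.inl (W_A_cons u s v)
  · rcases v with _ | ⟨s, v⟩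
    · exact Or.inr (W_B_nil u)
    · exact Or.inl (W_B_cons u s v)
  · exact Or.inl (W_C u v)

lemma W_steps (a : AC) (t : ℕ) : ∃ k, W (astep^[t] a) = T^[k] (W a) := by
  induction t with
  | zero => exact ⟨0, rfl⟩
  | succ t ih =>
    obtain ⟨k, hk⟩ := ih
    rw [Function.iterate_succ_apply']
    rcases W_step (astep^[t] a) with h | h
    · exact ⟨k, by rw [h, hk]⟩
    · exact ⟨k + 1, by rw [h, hk, Function.iterate_succ_apply']⟩

lemma sweep_right (v : List (Fin 3)) : ∀ (q : St) (u : List (Fin 3)), q ≠ C →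
    ∃ t u' v', astep^[t] (q, u, v) = (C, u', v') ∧ W (C, u', v') = T (W (q, u, v)) := by
  induction v with
  | nil =>
    intro q u hq
    cases q
    · exact ⟨1, u, [], rfl, W_A_nil u⟩
    · exact ⟨1, u, [2], rfl, W_B_nil u⟩
    · exact absurd rfl hq
  | cons s v ih =>
    intro q u hq
    have key : ∃ q' u', q' ≠ C ∧ astep (q, u, s :: v) = (q', u', v) ∧
        W (q', u', v) = W (q, u, s :: v) := by
      cases q
      · have := W_A_cons u s v
        fin_cases s
        · exact ⟨A, _, by simp, rfl, this⟩
        · exact ⟨B, _, by simp, rfl, this⟩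
        · exact ⟨A, _, by simp, rfl, this⟩
      · have := W_B_cons u s v
        fin_cases s
        · exact ⟨B, _, by simp, rfl, this⟩
        · exact ⟨A, _, by simp, rfl, this⟩
        · exact ⟨B, _, by simp, rfl, this⟩
      · exact absurd rfl hq
    obtain ⟨q', u1, hq', e, w⟩ := key
    obtain ⟨t, u', v', e', w'⟩ := ih q' u1 hq'
    exact ⟨t + 1, u', v', by rw [Function.iterate_succ_apply, e, e'], by rw [w', w]⟩

lemma sweep_left (u : List (Fin 3)) : ∀ v, ∃ t v', astep^[t] (C, u, v) = (A, [], v') ∧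
    W (A, [], v') = W (C, u, v) := by
  induction u with
  | nil => exact fun v => ⟨1, v, rfl, W_C [] v⟩
  | cons s u ih =>
    intro v
    obtain ⟨t, v', e, w⟩ := ih (s :: v)
    exact ⟨t + 1, v', by rw [Function.iterate_succ_apply]; exact e, by rw [w]; exact W_C (s :: u) v⟩

lemma run (k : ℕ) : ∀ v, ∃ t v', astep^[t] (A, [], v) = (A, [], v') ∧
    W (A, [], v') = T^[k] (W (A, [], v)) := by
  induction k with
  | zero => exact fun v => ⟨0, v, rfl, rfl⟩
  | succ k ih =>
    intro v
    obtain ⟨t1, u1, v1, e1, w1⟩ := sweep_right v A [] (by simp)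
    obtain ⟨t2, v2, e2, w2⟩ := sweep_left u1 v1
    obtain ⟨t3, v3, e3, w3⟩ := ih v2
    refine ⟨t3 + (t2 + t1), v3, ?_, ?_⟩
    · rw [Function.iterate_add_apply, Function.iterate_add_apply, e1, e2, e3]
    · rw [w3, w2, w1, Function.iterate_succ_apply]

lemma vl_zero (v : List (Fin 3)) (h : vl v + 3 ^ v.length = 1) : v = [] := by
  rcases v with _ | ⟨s, v⟩
  · rfl
  · have : 0 < 3 ^ v.length := by positivity
    simp only [List.length_cons, pow_succ] at h
    omega

lemma finish (v : List (Fin 3)) (h : vl v = 1) : ∀ n, ∃ t m,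
    astep^[t] (A, List.replicate n 0, v) = (A, List.replicate m 0, [1]) := by
  induction v with
  | nil => simp [vl] at h
  | cons s v ih =>
    intro n
    have hp : 0 < 3 ^ v.length := by positivity
    fin_cases s
    · obtain ⟨t, m, e⟩ := ih (by simpa [vl] using h) (n + 1)
      refine ⟨t + 1, m, ?_⟩
      rw [Function.iterate_succ_apply]
      exact e
    · simp [vl] at h
      have : v = [] := vl_zero v (by omega)
      subst this
      exact ⟨0, n, rfl⟩
    · simp [vl] at h
      omega

lemma list_ext (u : List (Fin 3)) : ∀ (w : List (Fin 3)),
    (∀ j, (u.map sy).getD j blank = (w.map sy).getD j blank) → u = w := by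
  have nb : ∀ s, sy s ≠ blank := by decide
  induction u with
  | nil =>
    intro w h
    rcases w with _ | ⟨s, w⟩
    · rfl
    · have := h 0
      simp at this
      exact absurd this.symm (nb s)
  | cons a u ih =>
    intro w h
    rcases w with _ | ⟨s, w⟩
    · have := h 0
      simp at this
      exact absurd this (nb a)
    · have h0 := h 0
      simp only [List.map_cons, List.getD_cons_zero] at h0
      have inj : ∀ a b, sy a = sy b → a = b := by decide
      rw [inj _ _ h0, ih w (fun j => by simpa using h (j + 1))]

lemma R_target (t : ℤ → Sym) (d : ℤ) (n : ℕ)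
    (ht : t = fun i => tapeOf (List.replicate n d0 ++ [d1]) (i - d)) :
    R t (d + n) (List.replicate n d0) [d1] := by
  subst ht
  intro j
  constructor
  · simp only [tapeOf]
    split_ifs with h
    · have e : (d + n - 1 - j - d).toNat = n - 1 - j := by omega
      have h1 : n - 1 - j < n := by omega
      have h2 : j < n := by omega
      rw [e]
      simp [List.getD_eq_getElem?_getD, List.getElem?_append, List.getElem?_replicate, h1, h2]
    · have h2 : ¬ j < n := by omega
      simp [List.getD_eq_getElem?_getD, List.getElem?_replicate, h2]
  · simp only [tapeOf]
    rw [if_pos (by omega)]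
    have e : (d + n + j - d).toNat = n + j := by omega
    rw [e]
    simp [List.getD_eq_getElem?_getD, List.getElem?_append]

lemma R_tape_unique {t t' : ℤ → Sym} {h u v} (H : R t h u v) (H' : R t' h u v) : t = t' := by
  funext i
  rcases le_or_gt h i with hi | hi
  · have e : i = h + ((i - h).toNat : ℤ) := by omega
    rw [e, (H _).2, (H' _).2]
  · have e : i = h - 1 - ((h - 1 - i).toNat : ℤ) := by omega
    rw [e, (H _).1, (H' _).1]

lemma good_target (c : Cfg) (n : ℕ) :
    IsConfig c A (List.replicate n d0 ++ [d1]) n ↔ Good c (A, List.replicate n 0, [1]) := by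
  constructor
  · rintro ⟨h1, d, h2, h3⟩
    refine ⟨h1, ?_⟩
    have := R_target c.tape d n h3
    simpa [off, h2, sy] using this
  · rintro ⟨h1, h2⟩
    refine ⟨h1, c.head - n, by ring, ?_⟩
    have := R_target _ (c.head - n) n rfl
    simp only [sub_add_cancel] at this
    simp only [off, add_zero, List.map_replicate, sy, List.map_cons, List.map_nil] at h2
    exact R_tape_unique h2 this

lemma good_unique {c q u v u' v'} (H : Good c (q, u, v)) (H' : Good c (q, u', v')) :
    u = u' ∧ v = v' :=
  ⟨list_ext _ _ fun j => by rw [← (H.2 j).1, ← (H'.2 j).1],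
    list_ext _ _ fun j => by rw [← (H.2 j).2, ← (H'.2 j).2]⟩

lemma vr_replicate (n : ℕ) : vr (List.replicate n 0) = 0 := by
  induction n with
  | zero => rfl
  | succ n ih => simp [List.replicate_succ, vr, ih]

lemma vl_append (v : List (Fin 3)) (s : Fin 3) : vl (v ++ [s]) = 3 * vl v + s.val := by
  induction v with
  | nil => simp [vl]
  | cons a v ih => simp [vl, ih]; ring

lemma exists_word (l : List ℕ) (hl : ∀ d ∈ l, d < 3) : ∃ v : List (Fin 3),
    l.reverse.map symOfDigit = v.map sy ∧ vl v = Nat.ofDigits 3 l := by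
  induction l with
  | nil => exact ⟨[], rfl, rfl⟩
  | cons a l ih =>
    obtain ⟨v, e, w⟩ := ih fun d hd => hl d (by simp [hd])
    have ha : a < 3 := hl a (by simp)
    refine ⟨v ++ [⟨a, ha⟩], ?_, ?_⟩
    · simp only [List.reverse_cons, List.map_append, e, List.map_cons, List.map_nil]
      congr 2
      interval_cases a <;> rfl
    · rw [vl_append, w, Nat.ofDigits_cons]
      simp
      ring

lemma good_init (x : ℕ) : ∃ v, Good (initCfg (base3Word x)) (A, [], v) ∧ W (A, [], v) = x := by
  obtain ⟨v, e, w⟩ := exists_word (Nat.digits 3 x) fun d hd => Nat.digits_lt_base (by norm_num) hd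
  refine ⟨v, ⟨rfl, ?_⟩, ?_⟩
  · intro j
    simp only [initCfg, base3Word, e, off, tapeOf]
    constructor
    · rw [if_neg (by omega)]
      simp
    · rw [if_pos (by omega)]
      simp
  · simp [W, vr, w, Nat.ofDigits_digits]

/-- The 3x+1 conjecture holds iff for every positive integer `x`, written in base 3
as `x_k … x_0` (most significant digit first), the machine `M1`, started from
`ωb (A x_k) x_{k-1} … x_0 bω`, eventually reaches `ωb 0^n (A 1) bω` for some `n ≥ 0`. -/
theorem collatz_iff_M1_reaches :
    CollatzConjecture ↔
      ∀ x : ℕ, 0 < x → ∃ n : ℕ,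
        Reaches (initCfg (base3Word x)) A (List.replicate n d0 ++ [d1]) n := by
  constructor
  · intro hC x hx
    obtain ⟨k, -, hk⟩ := hC x hx
    obtain ⟨v, hv, hW⟩ := good_init x
    obtain ⟨t, v', e, w⟩ := run (k + 1) v
    rw [hW, hk] at w
    obtain ⟨t', m, e'⟩ := finish v' (by simpa [W, vr] using w) 0
    obtain ⟨c', hc, hg⟩ := good_steps (t' + t) _ _ hv
    rw [Function.iterate_add_apply, e] at hg
    rw [List.replicate_zero] at e'
    rw [e'] at hg
    exact ⟨m, t' + t, c', hc, (good_target c' m).2 hg⟩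
  · intro h x hx
    obtain ⟨n, t, c', hc, hcfg⟩ := h x hx
    obtain ⟨v, hv, hW⟩ := good_init x
    obtain ⟨c2, hc2, hg⟩ := good_steps t _ _ hv
    rw [hc] at hc2
    cases hc2
    have hg' := (good_target c' n).1 hcfg
    obtain ⟨k, hk⟩ := W_steps (A, [], v) t
    rw [hW] at hk
    rcases hq : astep^[t] (A, [], v) with ⟨q, u', v'⟩
    rw [hq] at hg hk
    have hqA : q = A := by rw [← hcfg.1]; exact hg.1.symm
    subst hqA
    obtain ⟨rfl, rfl⟩ := good_unique hg hg'
    have h1 : T^[k] x = 1 := by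
      rw [← hk]
      simp [W, vr_replicate, vl]
    have h2 : T^[k + 1] x = 2 := by
      rw [Function.iterate_succ_apply', h1]
      rfl
    refine ⟨k + 1, h2, ?_⟩
    rw [Function.iterate_succ_apply', h2]
    rfl

end Collatz
end

section
/- Let x be a positive integer and let d_k…d_0 be any base-3 representation of x (most significant digit first, leading zeros allowed). Then the Turing machine M1, started from the configuration ωb (A d_k) d_{k−1} … d_0 bω, reaches after finitely many steps a configuration of the form ωb (A e_j) e_{j−1} … e_0 bω, where e_j…e_0 is a base-3 representation (possibly with leading zeros) of T(x). -/
namespace Collatz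

open St Sym

/-- Finite-time reachability between configurations. -/
def Rch (c c' : Cfg) : Prop := ∃ t : ℕ, steps t c = some c'

lemma Rch.refl (c : Cfg) : Rch c c := ⟨0, rfl⟩

lemma Rch.head {c c₁ c₂ : Cfg} (h : step c = some c₁) (h2 : Rch c₁ c₂) : Rch c c₂ := by
  obtain ⟨t, ht⟩ := h2
  exact ⟨t + 1, by simp [steps, h, ht]⟩

lemma Rch.trans {a c d : Cfg} (h : Rch a c) (h2 : Rch c d) : Rch a d := by
  obtain ⟨t, ht⟩ := h
  induction t generalizing a with
  | zero => simp only [steps, Option.some.injEq] at ht; exact ht ▸ h2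
  | succ n ih =>
    simp only [steps, Option.bind_eq_some_iff] at ht
    obtain ⟨b, hb, hb2⟩ := ht
    exact Rch.head hb (ih hb2)

lemma tapeOf_nat (w : List Sym) (n : ℕ) : tapeOf w (n : ℤ) = w.getD n blank := by
  simp [tapeOf]

lemma tapeOf_mid (u v : List Sym) (s : Sym) : tapeOf (u ++ s :: v) (u.length : ℤ) = s := by
  simp [tapeOf_nat]

lemma tapeOf_blank (w : List Sym) : tapeOf (w ++ [blank]) = tapeOf w := by
  funext i
  unfold tapeOf
  split_ifs
  · simp only [List.getD_eq_getElem?_getD, List.getElem?_append]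
    split_ifs with h
    · rfl
    · rw [List.getElem?_eq_none (l := w) (by omega)]
      cases h : i.toNat - w.length <;> simp
  · rfl

lemma update_mid (u v : List Sym) (s s' : Sym) :
    Function.update (tapeOf (u ++ s :: v)) (u.length : ℤ) s' = tapeOf (u ++ s' :: v) := by
  funext i
  by_cases hi : i = u.length
  · subst hi; rw [Function.update_self, tapeOf_mid]
  · rw [Function.update_of_ne hi]
    unfold tapeOf
    split_ifs
    · simp only [List.getD_eq_getElem?_getD, List.getElem?_append]
      split_ifs with h
      · rfl
      · obtain ⟨k, hk⟩ : ∃ k, i.toNat - u.length = k + 1 :=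
          ⟨i.toNat - u.length - 1, by omega⟩
        rw [hk]; simp
    · rfl

lemma step_mid {q q' : St} {s s' : Sym} {b : Bool} (u v : List Sym)
    (h : delta q s = some (s', b, q')) :
    step ⟨q, u.length, tapeOf (u ++ s :: v)⟩ =
      some ⟨q', u.length + (if b then 1 else -1), tapeOf (u ++ s' :: v)⟩ := by
  simp [step, tapeOf_mid, h, update_mid]

/-- State carrying remainder `r`. -/
def stOf (r : ℕ) : St := if r = 0 then A else B

lemma delta_digit (r d : ℕ) (hr : r < 2) (hd : d < 3) :
    delta (stOf r) (symOfDigit d) =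
      some (symOfDigit ((3 * r + d) / 2), true, stOf ((3 * r + d) % 2)) := by
  interval_cases r <;> interval_cases d <;> rfl

lemma forward (ds : List ℕ) (hlt : ∀ d ∈ ds, d < 3) (r : ℕ) (hr : r < 2) (u : List Sym) :
    ∃ es : List ℕ, ∃ r' : ℕ, r' < 2 ∧ es.length = ds.length ∧ (∀ e ∈ es, e < 3) ∧
      r * 3 ^ ds.length + Nat.ofDigits 3 ds.reverse = 2 * Nat.ofDigits 3 es.reverse + r' ∧
      Rch ⟨stOf r, u.length, tapeOf (u ++ ds.map symOfDigit)⟩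
        ⟨stOf r', (u ++ es.map symOfDigit).length, tapeOf (u ++ es.map symOfDigit)⟩ := by
  induction ds generalizing r u with
  | nil => exact ⟨[], r, hr, rfl, by simp, by simp, by simpa using Rch.refl _⟩
  | cons d ds ih =>
    have hd : d < 3 := hlt d (by simp)
    obtain ⟨es, r', hr', hlen, hes, hval, hR⟩ := ih (fun e he => hlt e (by simp [he]))
      ((3 * r + d) % 2) (by omega) (u ++ [symOfDigit ((3 * r + d) / 2)])
    refine ⟨((3 * r + d) / 2) :: es, r', hr', by simp [hlen], ?_, ?_, ?_⟩
    · intro e he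
      rcases List.mem_cons.1 he with rfl | he
      · omega
      · exact hes e he
    · simp only [List.reverse_cons, Nat.ofDigits_append, List.length_reverse, List.length_cons,
        Nat.ofDigits_singleton, hlen]
      have h := Nat.div_add_mod (3 * r + d) 2
      generalize (3 * r + d) / 2 = a at *
      generalize (3 * r + d) % 2 = b at *
      rw [pow_succ]
      have h2 : 3 ^ ds.length * (2 * a + b) = 3 ^ ds.length * (3 * r + d) := by rw [h]
      linarith
    · refine Rch.head (step_mid u (ds.map symOfDigit) (delta_digit r d hr hd)) ?_
      simpa using hR

lemma backward (w : List Sym) (hw : ∀ s ∈ w, s ≠ blank) (n : ℕ) (hn : n ≤ w.length) :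
    Rch ⟨C, (n : ℤ) - 1, tapeOf w⟩ ⟨A, 0, tapeOf w⟩ := by
  induction n with
  | zero =>
    refine Rch.head (c₁ := ⟨A, 0, tapeOf w⟩) ?_ (Rch.refl _)
    have h : tapeOf w (-1) = blank := rfl
    have h2 : Function.update (tapeOf w) (-1) blank = tapeOf w := by
      rw [← h, Function.update_eq_self]
    simp [step, h, delta, h2]
  | succ n ih =>
    refine Rch.head ?_ (ih (by omega))
    have h : tapeOf w (n : ℤ) = w[n] := by
      rw [tapeOf_nat]; exact List.getD_eq_getElem _ _ (by omega)
    have h2 : tapeOf w (n : ℤ) ≠ blank := by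
      rw [h]; exact hw _ (List.getElem_mem _)
    have h3 : delta C (tapeOf w (n : ℤ)) = some (tapeOf w (n : ℤ), false, C) := by
      revert h2
      cases tapeOf w (n : ℤ) <;> simp [delta]
    simp [step, h3, sub_eq_add_neg]

lemma symOfDigit_ne (n : ℕ) : symOfDigit n ≠ blank := by
  unfold symOfDigit; split_ifs <;> simp

lemma finish_s1 (es : List ℕ) (n : ℕ) (hn : n ≤ es.length) :
    Rch ⟨C, (n : ℤ) - 1, tapeOf (es.map symOfDigit)⟩ ⟨A, 0, tapeOf (es.map symOfDigit)⟩ := by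
  refine backward _ ?_ n (by simpa using hn)
  intro s hs
  obtain ⟨e, -, rfl⟩ := List.mem_map.1 hs
  exact symOfDigit_ne e

lemma Rch.reaches {c : Cfg} {w : List Sym} (h : Rch c ⟨A, 0, tapeOf w⟩) : Reaches c A w 0 := by
  obtain ⟨t, ht⟩ := h
  exact ⟨t, _, ht, rfl, 0, by simp, by simp⟩

/-- If `d_k … d_0` is any base-3 representation of the positive integer `x`
(most significant digit first, leading zeros allowed), then `M1`, started from
`ωb (A d_k) d_{k-1} … d_0 bω`, reaches after finitely many steps a configuration
`ωb (A e_j) e_{j-1} … e_0 bω` where `e_j … e_0` is some base-3 representation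
(possibly with leading zeros) of `T x`. -/
theorem M1_simulates_T (x : ℕ) (hx : 0 < x) (ds : List ℕ) (hne : ds ≠ [])
    (hlt : ∀ d ∈ ds, d < 3) (hval : Nat.ofDigits 3 ds.reverse = x) :
    ∃ es : List ℕ, es ≠ [] ∧ (∀ e ∈ es, e < 3) ∧
      Nat.ofDigits 3 es.reverse = T x ∧
      Reaches (initCfg (ds.map symOfDigit)) A (es.map symOfDigit) 0 := by
  obtain ⟨es, r', hr', hlen, hes, hv, hR⟩ := forward ds hlt 0 (by omega) []
  have hpos : 0 < ds.length := List.length_pos_iff.2 hne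
  have hne' : es ≠ [] := List.length_pos_iff.1 (by omega)
  rw [hval] at hv
  simp only [List.nil_append, List.length_nil, zero_mul, zero_add] at hv hR
  interval_cases r'
  · refine ⟨es, hne', hes, ?_, Rch.reaches (Rch.trans hR ?_)⟩
    · unfold T; split_ifs <;> omega
    · have h := step_mid (q := A) (s := blank) (es.map symOfDigit) [] rfl
      rw [tapeOf_blank] at h
      refine Rch.head h ?_
      simpa [sub_eq_add_neg] using finish_s1 es es.length le_rfl
  · refine ⟨es ++ [2], by simp, ?_, ?_, Rch.reaches (Rch.trans hR ?_)⟩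
    · intro e he
      rcases List.mem_append.1 he with he | he
      · exact hes e he
      · simp at he; omega
    · simp only [List.reverse_append, List.reverse_singleton, List.singleton_append,
        Nat.ofDigits_cons]
      unfold T; split_ifs <;> push_cast <;> omega
    · have h := step_mid (q := B) (s := blank) (es.map symOfDigit) [] rfl
      rw [tapeOf_blank] at h
      refine Rch.head h ?_
      have h2 := finish_s1 (es ++ [2]) es.length (by simp)
      have h3 : (es ++ [2]).map symOfDigit = es.map symOfDigit ++ [d2] := by
        rw [List.map_append]; rfl
      rw [h3] at h2 ⊢
      simpa [sub_eq_add_neg] using h2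

end Collatz
end
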